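/- arXiv:2605.01958 — 9 statements merged into one kernel-verified Lean document; each statement's English description precedes it below -/
import Mathlib

section
/- Fix an integer n ≥ 2 and a real number a, and let R be the n×n real matrix with R_ii = 1 for all i and R_ij = a/(n−1) for all i ≠ j. Then R is completely-𝒮 if and only if a > −1. -/
open MeasureTheory Set

noncomputable def nnegPart (r : ℝ) : ℝ := max (-r) 0

open Classical in
noncomputable def lsMeasure (f : ℝ → ℝ) : Measure ℝ :=
  if h : Monotone f ∧ Continuous f then
    StieltjesFunction.measure
      { toFun := f, mono' := h.1, right_continuous' := fun _ => h.2.continuousWithinAt }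
  else 0

def IsBoundaryTerm (x ℓ : ℝ → ℝ) : Prop :=
  Continuous ℓ ∧ Monotone ℓ ∧ (∀ s ≤ (0:ℝ), ℓ s = 0) ∧
    ∫⁻ s in Set.Ici (0:ℝ), ENNReal.ofReal (x s) ∂(lsMeasure ℓ) = 0

noncomputable def supNorm (f : ℝ → ℝ) (t : ℝ) : ℝ :=
  sSup ((fun s => |f s|) '' Set.Icc 0 t)

noncomputable def modCont (f : ℝ → ℝ) (t δ : ℝ) : ℝ :=
  sSup ((fun p : ℝ × ℝ => |f p.1 - f p.2|) ''
    {p : ℝ × ℝ | p.1 ∈ Set.Icc 0 t ∧ p.2 ∈ Set.Icc 0 t ∧ |p.1 - p.2| ≤ δ})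

noncomputable def penalty (ε : ℝ) (x : ℝ) : ℝ :=
  if x ≤ -ε then ε⁻¹ else if x < 0 then -(x / ε ^ 2) else 0

def HomogeneousSystem (n : ℕ) (a : ℝ) (x0 : Fin n → ℝ)
    (w x ℓ : Fin n → ℝ → ℝ) : Prop :=
  (∀ i, 0 ≤ x0 i) ∧ (∀ i, Continuous (w i)) ∧ (∀ i, w i 0 = 0) ∧
  (∀ i, Continuous (x i)) ∧ (∀ i t, 0 ≤ t → 0 ≤ x i t) ∧
  (∀ i, IsBoundaryTerm (x i) (ℓ i)) ∧
  (∀ i t, 0 ≤ t → x i t = x0 i + w i t + ℓ i t +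
      a * (((n : ℝ) - 1)⁻¹ * ∑ j ∈ Finset.univ.erase i, ℓ j t))

def CompletelyS {n : ℕ} (R : Matrix (Fin n) (Fin n) ℝ) : Prop :=
  ∀ J : Finset (Fin n), J.Nonempty →
    ∃ x : Fin n → ℝ, (∀ j ∈ J, 0 ≤ x j) ∧ ∀ i ∈ J, 0 < ∑ j ∈ J, R i j * x j

theorem sum_eq_one_add_card_sub_one_mul {ι : Type*} [DecidableEq ι] (f : ι → ℝ) (c : ℝ)
    {J : Finset ι} {i : ι} (hi : i ∈ J) (hdiag : f i = 1) (hoff : ∀ j, j ≠ i → f j = c) :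
    ∑ j ∈ J, f j = 1 + ((J.card : ℝ) - 1) * c := by
  rw [← Finset.add_sum_erase J f hi, hdiag,
    Finset.sum_congr rfl fun j hj => hoff j (Finset.ne_of_mem_erase hj), Finset.sum_const,
    nsmul_eq_mul, Finset.cast_card_erase_of_mem hi]

theorem stmt0 (n : ℕ) (hn : 2 ≤ n) (a : ℝ)
    (R : Matrix (Fin n) (Fin n) ℝ)
    (hdiag : ∀ i, R i i = 1)
    (hoff : ∀ i j, i ≠ j → R i j = a / ((n : ℝ) - 1)) :
    CompletelyS R ↔ -1 < a := by
  have hn1 : (0 : ℝ) < (n : ℝ) - 1 := by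
    have : (2 : ℝ) ≤ n := by exact_mod_cast hn
    linarith
  have hmul : ((n : ℝ) - 1) * (a / ((n : ℝ) - 1)) = a := mul_div_cancel₀ a hn1.ne'
  constructor
  · intro h
    have hne : (Finset.univ : Finset (Fin n)).Nonempty := ⟨⟨0, by omega⟩, Finset.mem_univ _⟩
    obtain ⟨x, hx, hpos⟩ := h Finset.univ hne
    have hcol : ∀ j, ∑ i, R i j = 1 + a := fun j => by
      rw [sum_eq_one_add_card_sub_one_mul (fun i => R i j) _ (Finset.mem_univ j) (hdiag j)
        fun i hij => hoff i j hij, Finset.card_univ, Fintype.card_fin, hmul]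
    have hsum : 0 < (1 + a) * ∑ j, x j := by
      have := Finset.sum_pos hpos hne
      rw [Finset.sum_comm] at this
      simpa only [← Finset.sum_mul, hcol, ← Finset.mul_sum] using this
    linarith [pos_of_mul_pos_left hsum (Finset.sum_nonneg hx)]
  · intro ha J _
    refine ⟨fun _ => 1, fun _ _ => zero_le_one, fun i hi => ?_⟩
    simp only [mul_one]
    rw [sum_eq_one_add_card_sub_one_mul (R i) _ hi (hdiag i) fun j hj => hoff i j hj.symm]
    have hJ1 : (1 : ℝ) ≤ J.card := by exact_mod_cast Finset.card_pos.mpr ⟨i, hi⟩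
    have hJn : (J.card : ℝ) ≤ n := by exact_mod_cast card_finset_fin_le J
    rcases le_total 0 (a / ((n : ℝ) - 1)) with hc | hc
    · linarith [mul_nonneg (sub_nonneg.mpr hJ1) hc]
    · linarith [mul_le_mul_of_nonpos_right (sub_le_sub_right hJn 1) hc]
end

section
/- Let w : [0,∞) → ℝ be continuous with w(0) ≥ 0, let x : [0,∞) → [0,∞) be continuous, and let ℓ : [0,∞) → [0,∞) be continuous and nondecreasing with ℓ(0) = 0 and ∫_{[0,∞)} x(s) dℓ(s) = 0, the integral taken with respect to the Lebesgue–Stieltjes measure induced by ℓ. If x(t) = w(t) + ℓ(t) for all t ≥ 0, then ℓ(t) = sup_{s∈[0,t]} (w(s))⁻ for every t ≥ 0. -/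
open MeasureTheory Set

theorem lsMeasure_Ioc {f : ℝ → ℝ} (hf : Monotone f) (hc : Continuous f) (a b : ℝ) :
    lsMeasure f (Ioc a b) = ENNReal.ofReal (f b - f a) := by
  rw [lsMeasure, dif_pos ⟨hf, hc⟩, StieltjesFunction.measure_Ioc]

/-- A boundary term does not grow on an interval where `x` is positive. -/
theorem IsBoundaryTerm.le_of_pos {x ℓ : ℝ → ℝ} (hb : IsBoundaryTerm x ℓ) (hx : Measurable x)
    {a b : ℝ} (ha : 0 ≤ a) (hpos : ∀ s ∈ Ioc a b, 0 < x s) : ℓ b ≤ ℓ a := by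
  obtain ⟨hc, hm, -, hint⟩ := hb
  by_contra! hlt
  have hmass : 0 < lsMeasure ℓ (Ioc a b) := by
    rw [lsMeasure_Ioc hm hc]
    exact ENNReal.ofReal_pos.2 (sub_pos.2 hlt)
  have hsub : Ioc a b ⊆ Function.support (fun s => ENNReal.ofReal (x s)) ∩ Ici 0 :=
    fun s hs => ⟨(ENNReal.ofReal_pos.2 (hpos s hs)).ne', ha.trans hs.1.le⟩
  exact ((setLIntegral_pos_iff hx.ennreal_ofReal).2 (hmass.trans_le (measure_mono hsub))).ne' hint

theorem stmt1 (w x ℓ : ℝ → ℝ)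
    (hw : Continuous w) (hw0 : 0 ≤ w 0)
    (hx : Continuous x) (hxnn : ∀ t, 0 ≤ t → 0 ≤ x t)
    (hb : IsBoundaryTerm x ℓ)
    (heq : ∀ t, 0 ≤ t → x t = w t + ℓ t) :
    ∀ t, 0 ≤ t → ℓ t = sSup ((fun s => nnegPart (w s)) '' Set.Icc 0 t) := by
  intro t ht
  have hle : ∀ s ∈ Icc 0 t, nnegPart (w s) ≤ ℓ t := by
    intro s hs
    have hst : ℓ s ≤ ℓ t := hb.2.1 hs.2
    have h0s : ℓ 0 ≤ ℓ s := hb.2.1 hs.1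
    have h0 : ℓ 0 = 0 := hb.2.2.1 0 le_rfl
    have hxs := hxnn s hs.1
    have hes := heq s hs.1
    exact max_le (by linarith) (by linarith)
  have hne : ((fun s => nnegPart (w s)) '' Icc 0 t).Nonempty := (nonempty_Icc.2 ht).image _
  have hbdd : BddAbove ((fun s => nnegPart (w s)) '' Icc 0 t) :=
    ⟨ℓ t, forall_mem_image.2 hle⟩
  refine le_antisymm ?_ (csSup_le hne (forall_mem_image.2 hle))
  set S := sSup ((fun s => nnegPart (w s)) '' Icc 0 t)
  have hS : ∀ s ∈ Icc 0 t, nnegPart (w s) ≤ S := fun s hs =>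
    le_csSup hbdd (mem_image_of_mem _ hs)
  have hcompact : IsCompact (Icc 0 t ∩ {s | ℓ s ≤ S}) :=
    isCompact_Icc.inter_right (isClosed_le hb.1 continuous_const)
  have hzero : (0 : ℝ) ∈ Icc 0 t ∩ {s | ℓ s ≤ S} := by
    refine ⟨left_mem_Icc.2 ht, ?_⟩
    rw [mem_ofPred_eq, hb.2.2.1 0 le_rfl]
    exact (le_max_right _ _).trans (hS 0 (left_mem_Icc.2 ht))
  obtain ⟨σ, ⟨hσ, hσS⟩, hmax⟩ := hcompact.exists_isGreatest ⟨0, hzero⟩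
  refine (hb.le_of_pos hx.measurable hσ.1 fun s hs => ?_).trans hσS
  have hst : s ∈ Icc 0 t := ⟨hσ.1.trans hs.1.le, hs.2⟩
  have hlt : S < ℓ s := by
    by_contra! h
    exact (hmax ⟨hst, h⟩).not_gt hs.1
  have hws : -w s ≤ S := (le_max_left _ _).trans (hS s hst)
  rw [heq s hst.1]
  linarith
end

section
/- For continuous functions f, g : [0,∞) → ℝ and every t ≥ 0, one has |sup_{s∈[0,t]} (f(s))⁻ − sup_{s∈[0,t]} (g(s))⁻| ≤ sup_{s∈[0,t]} |f(s) − g(s)|. That is, the one-dimensional Skorokhod reflection map w ↦ sup_{s≤·} (w(s))⁻ is 1-Lipschitz with respect to the uniform norm on [0,t]. -/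
open MeasureTheory Set

theorem continuous_nnegPart : Continuous nnegPart :=
  continuous_neg.max continuous_const

theorem nnegPart_le_add_abs_sub (a b : ℝ) : nnegPart a ≤ nnegPart b + |a - b| := by
  have hb : -b ≤ nnegPart b := le_max_left _ _
  have hb' : 0 ≤ nnegPart b := le_max_right _ _
  exact max_le (by linarith [neg_abs_le (a - b)]) (by positivity)

theorem sSup_nnegPart_le_add {f g : ℝ → ℝ} (hf : Continuous f) (hg : Continuous g)
    {K : Set ℝ} (hK : IsCompact K) (hne : K.Nonempty) :
    sSup ((fun s => nnegPart (f s)) '' K) ≤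
      sSup ((fun s => nnegPart (g s)) '' K) + sSup ((fun s => |f s - g s|) '' K) := by
  refine csSup_le (hne.image _) ?_
  rintro _ ⟨s, hs, rfl⟩
  refine (nnegPart_le_add_abs_sub (f s) (g s)).trans (add_le_add ?_ ?_)
  · exact le_csSup (hK.bddAbove_image (continuous_nnegPart.comp hg).continuousOn)
      (mem_image_of_mem _ hs)
  · exact le_csSup (hK.bddAbove_image (hf.sub hg).abs.continuousOn) (mem_image_of_mem _ hs)

theorem stmt3 (f g : ℝ → ℝ) (hf : Continuous f) (hg : Continuous g)
    (t : ℝ) (ht : 0 ≤ t) :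
    |sSup ((fun s => nnegPart (f s)) '' Set.Icc 0 t)
      - sSup ((fun s => nnegPart (g s)) '' Set.Icc 0 t)|
    ≤ sSup ((fun s => |f s - g s|) '' Set.Icc 0 t) := by
  have hne : (Set.Icc 0 t).Nonempty := nonempty_Icc.2 ht
  have hfg := sSup_nnegPart_le_add hf hg isCompact_Icc hne
  have hgf := sSup_nnegPart_le_add hg hf isCompact_Icc hne
  simp only [abs_sub_comm (g _) (f _)] at hgf
  exact abs_sub_le_iff.2 ⟨by linarith, by linarith⟩
end

section
/- Fix n ≥ 2 and real numbers r_ij for i, j ∈ {1,…,n}, i ≠ j. For each i let x_{0,i} ≥ 0, let w_i : [0,∞) → ℝ be continuous with w_i(0) = 0, let x_i : [0,∞) → [0,∞) be continuous, and let ℓ_i be a boundary term for x_i, and suppose x_i(t) = x_{0,i} + w_i(t) + ℓ_i(t) + ∑_{j≠i} r_ij ℓ_j(t) for all t ≥ 0 and all i. Then for every i and every t ≥ 0, ℓ_i(t) = sup_{s∈[0,t]} ( (x_{0,i} + w_i(s) + ∑_{j≠i} r_ij ℓ_j(s))⁻ ). -/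
open MeasureTheory Set

/-- A boundary term does not increase on an interval where the path is positive. -/
theorem IsBoundaryTerm.eq_of_pos {x ℓ : ℝ → ℝ} (hx : Continuous x) (h : IsBoundaryTerm x ℓ)
    {a b : ℝ} (ha : 0 ≤ a) (hab : a ≤ b) (hpos : ∀ s ∈ Ioc a b, 0 < x s) : ℓ a = ℓ b := by
  obtain ⟨hc, hm, -, hint⟩ := h
  have hmeas : Measurable fun s => ENNReal.ofReal (x s) := hx.measurable.ennreal_ofReal
  rw [lintegral_eq_zero_iff hmeas, Filter.EventuallyEq,
    ae_restrict_iff' measurableSet_Ici, ae_iff] at hint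
  have hnull : lsMeasure ℓ (Ioc a b) = 0 := by
    refine measure_mono_null (fun s hs => ?_) hint
    simpa using ⟨ha.trans hs.1.le, hpos s hs⟩
  rw [lsMeasure, dif_pos ⟨hm, hc⟩, StieltjesFunction.measure_Ioc,
    ENNReal.ofReal_eq_zero] at hnull
  have hle : ℓ b - ℓ a ≤ 0 := hnull
  linarith [hm hab]

/-- The current value of a boundary term was first attained at a zero of the path,
unless that value is zero. -/
theorem IsBoundaryTerm.exists_eq_zero {x ℓ : ℝ → ℝ} (hx : Continuous x)
    (hxnn : ∀ t, 0 ≤ t → 0 ≤ x t) (h : IsBoundaryTerm x ℓ) {t : ℝ} (ht : 0 ≤ t)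
    (hpos : 0 < ℓ t) : ∃ s ∈ Icc 0 t, ℓ s = ℓ t ∧ x s = 0 := by
  have hK : IsCompact (Icc 0 t ∩ ℓ ⁻¹' {ℓ t}) :=
    isCompact_Icc.inter_right (isClosed_singleton.preimage h.1)
  obtain ⟨s, ⟨⟨hs, hsl⟩, hmin⟩⟩ := hK.exists_isLeast ⟨t, ⟨ht, le_rfl⟩, rfl⟩
  have hsl : ℓ s = ℓ t := hsl
  refine ⟨s, hs, hsl, ?_⟩
  by_contra hne
  have hxs : 0 < x s := lt_of_le_of_ne (hxnn s hs.1) (Ne.symm hne)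
  have hs0 : 0 < s := by
    by_contra hle
    linarith [h.2.2.1 s (not_lt.mp hle)]
  obtain ⟨a, ha, hsub⟩ := exists_Ioc_subset_of_mem_nhds'
    (hx.continuousAt.eventually (lt_mem_nhds hxs)) hs0
  have hal : ℓ a = ℓ s := h.eq_of_pos hx ha.1 ha.2.le fun u hu => hsub hu
  exact absurd (hmin ⟨⟨ha.1, ha.2.le.trans hs.2⟩, hal.trans hsl⟩) (not_le.mpr ha.2)

/-- The one-dimensional Skorokhod formula for the boundary term. -/
theorem IsBoundaryTerm.isGreatest {x y ℓ : ℝ → ℝ} (hx : Continuous x)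
    (hxnn : ∀ t, 0 ≤ t → 0 ≤ x t) (h : IsBoundaryTerm x ℓ)
    (heq : ∀ t, 0 ≤ t → x t = y t + ℓ t) {t : ℝ} (ht : 0 ≤ t) :
    IsGreatest ((fun s => nnegPart (y s)) '' Icc 0 t) (ℓ t) := by
  have hnn : ∀ s, 0 ≤ s → 0 ≤ ℓ s := fun s hs => (h.2.2.1 0 le_rfl).symm.trans_le (h.2.1 hs)
  have hub : ∀ s ∈ Icc 0 t, nnegPart (y s) ≤ ℓ t := fun s hs =>
    max_le (by linarith [hxnn s hs.1, heq s hs.1, h.2.1 hs.2]) (hnn t ht)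
  refine ⟨?_, forall_mem_image.mpr hub⟩
  rcases (hnn t ht).eq_or_lt with h0 | hpos
  · exact ⟨t, ⟨ht, le_rfl⟩,
      le_antisymm (hub t ⟨ht, le_rfl⟩) (h0.symm.trans_le (le_max_right _ _))⟩
  · obtain ⟨s, hs, hsl, hxs⟩ := h.exists_eq_zero hx hxnn ht hpos
    refine ⟨s, hs, le_antisymm (hub s hs) (le_trans ?_ (le_max_left _ _))⟩
    linarith [heq s hs.1]


theorem stmt4 (n : ℕ) (hn : 2 ≤ n) (r : Fin n → Fin n → ℝ)
    (x0 : Fin n → ℝ) (hx0 : ∀ i, 0 ≤ x0 i)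
    (w x ℓ : Fin n → ℝ → ℝ)
    (hw : ∀ i, Continuous (w i)) (hw0 : ∀ i, w i 0 = 0)
    (hx : ∀ i, Continuous (x i)) (hxnn : ∀ i t, 0 ≤ t → 0 ≤ x i t)
    (hb : ∀ i, IsBoundaryTerm (x i) (ℓ i))
    (heq : ∀ i t, 0 ≤ t → x i t = x0 i + w i t + ℓ i t
        + ∑ j ∈ Finset.univ.erase i, r i j * ℓ j t) :
    ∀ i t, 0 ≤ t →
      ℓ i t = sSup ((fun s =>
        nnegPart (x0 i + w i s + ∑ j ∈ Finset.univ.erase i, r i j * ℓ j s)) '' Set.Icc 0 t) := by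
  intro i t ht
  exact ((hb i).isGreatest (hx i) (hxnn i)
    (fun s hs => (heq i s hs).trans (by ring)) ht).csSup_eq.symm
end

section
/- Let a ≥ 0 and let (x_{0,i}, w_i, x_i, ℓ_i)_{i=1,…,n} be a homogeneous reflected system with parameter a. Then for every i: (1) ℓ_i(t) ≤ sup_{s∈[0,t]} (w_i(s))⁻ ≤ ‖w_i‖_t for all t ≥ 0; and (2) for every T ≥ 0 and 0 ≤ δ ≤ T, w_T(ℓ_i, δ) ≤ w_T(w_i, δ). -/
open MeasureTheory Set

namespace IsBoundaryTerm

variable {x ℓ : ℝ → ℝ}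

/-- A boundary term is constant on intervals where `x` is bounded away from zero. -/
theorem eq_of_le (h : IsBoundaryTerm x ℓ) {p q c : ℝ} (hp : 0 ≤ p) (hpq : p ≤ q) (hc : 0 < c)
    (hx : ∀ r ∈ Ioc p q, c ≤ x r) : ℓ p = ℓ q := by
  obtain ⟨hcont, hmono, -, hint⟩ := h
  have hle : ENNReal.ofReal c * lsMeasure ℓ (Ioc p q) ≤ 0 := by
    rw [← setLIntegral_const, ← hint]
    exact (setLIntegral_mono' measurableSet_Ioc
      fun r hr => ENNReal.ofReal_le_ofReal (hx r hr)).trans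
      (lintegral_mono_set fun r hr => hp.trans hr.1.le)
  have hzero : lsMeasure ℓ (Ioc p q) = 0 :=
    (mul_eq_zero.1 (le_antisymm hle zero_le)).resolve_left (by simpa using hc)
  rw [lsMeasure, dif_pos ⟨hmono, hcont⟩, StieltjesFunction.measure_Ioc,
    ENNReal.ofReal_eq_zero] at hzero
  exact le_antisymm (hmono hpq) (sub_nonpos.1 hzero)

/-- If a boundary term increases on `[s, t]`, it reaches its final value at a zero of `x`. -/
theorem exists_zero_of_lt (h : IsBoundaryTerm x ℓ) (hxc : Continuous x)
    (hx : ∀ r, 0 ≤ r → 0 ≤ x r) {s t : ℝ} (hs : 0 ≤ s) (hst : s ≤ t) (hlt : ℓ s < ℓ t) :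
    ∃ u ∈ Icc s t, x u = 0 ∧ ℓ u = ℓ t := by
  obtain ⟨u, ⟨hu, hut⟩, hleast⟩ :=
    (isCompact_Icc.inter_right (isClosed_eq h.1 continuous_const)).exists_isLeast
      (⟨t, ⟨hst, le_rfl⟩, rfl⟩ : (Icc s t ∩ {r | ℓ r = ℓ t}).Nonempty)
  refine ⟨u, hu, ?_, hut⟩
  by_contra hne
  have hpos : 0 < x u := lt_of_le_of_ne (hx u (hs.trans hu.1)) (Ne.symm hne)
  have hsu : s < u := lt_of_le_of_ne hu.1 fun hsu => hlt.ne (hsu ▸ hut)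
  obtain ⟨ε, hε, hball⟩ := Metric.eventually_nhds_iff.1
    (hxc.continuousAt.eventually_const_lt (half_lt_self hpos))
  have hpu : max s (u - ε / 2) < u := max_lt hsu (by linarith)
  have hsp : s ≤ max s (u - ε / 2) := le_max_left _ _
  have hup : u - ε / 2 ≤ max s (u - ε / 2) := le_max_right _ _
  have heq : ℓ (max s (u - ε / 2)) = ℓ u :=
    h.eq_of_le (hs.trans hsp) hpu.le (half_pos hpos) fun r hr => (hball (by
      rw [Real.dist_eq, abs_lt]
      constructor <;> linarith [hr.1, hr.2])).le
  exact hpu.not_ge (hleast ⟨⟨hsp, hpu.le.trans hu.2⟩, heq.trans hut⟩)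

end IsBoundaryTerm

/-- The oscillation over any two points at distance at most `δ` is bounded by the modulus. -/
theorem abs_sub_le_modCont {f : ℝ → ℝ} (hf : Continuous f) {T δ s u : ℝ} (hs : s ∈ Icc 0 T)
    (hu : u ∈ Icc 0 T) (hδ : |s - u| ≤ δ) : |f s - f u| ≤ modCont f T δ := by
  refine le_csSup ?_ ⟨(s, u), ⟨hs, hu, hδ⟩, rfl⟩
  refine ((isCompact_Icc (a := (0 : ℝ)) (b := T)).prod
    (isCompact_Icc (a := (0 : ℝ)) (b := T))).bddAbove_image
    (f := fun p : ℝ × ℝ => |f p.1 - f p.2|) (by fun_prop) |>.mono (image_mono ?_)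
  exact fun p hp => ⟨hp.1, hp.2.1⟩

theorem modCont_nonneg (f : ℝ → ℝ) (T δ : ℝ) : 0 ≤ modCont f T δ := by
  refine Real.sSup_nonneg ?_
  rintro _ ⟨p, -, rfl⟩
  exact abs_nonneg _

namespace HomogeneousSystem

variable {n : ℕ} {a : ℝ} {x0 : Fin n → ℝ} {w x ℓ : Fin n → ℝ → ℝ}

theorem interaction_mono (h : HomogeneousSystem n a x0 w x ℓ) (hn : 1 ≤ n) (ha : 0 ≤ a)
    (i : Fin n) :
    Monotone fun t => a * (((n : ℝ) - 1)⁻¹ * ∑ j ∈ Finset.univ.erase i, ℓ j t) := by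
  obtain ⟨-, -, -, -, -, hb, -⟩ := h
  intro s t hst
  have hn' : (0 : ℝ) ≤ ((n : ℝ) - 1)⁻¹ := by
    rw [inv_nonneg, sub_nonneg]
    exact_mod_cast hn
  exact mul_le_mul_of_nonneg_left (mul_le_mul_of_nonneg_left
    (Finset.sum_le_sum fun j _ => (hb j).2.1 hst) hn') ha

/-- An increase of `ℓ i` on `[s, t]` is compensated by a decrease of `w i` from `s`. -/
theorem exists_sub_le_of_lt (h : HomogeneousSystem n a x0 w x ℓ) (hn : 1 ≤ n) (ha : 0 ≤ a)
    (i : Fin n) {s t : ℝ} (hs : 0 ≤ s) (hst : s ≤ t) (hlt : ℓ i s < ℓ i t) :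
    ∃ u ∈ Icc s t, ℓ i t - ℓ i s ≤ w i s - w i u := by
  have hmono := h.interaction_mono hn ha i
  obtain ⟨-, -, -, hxc, hx, hb, heq⟩ := h
  obtain ⟨u, hu, hxu, hlu⟩ := (hb i).exists_zero_of_lt (hxc i) (hx i) hs hst hlt
  refine ⟨u, hu, ?_⟩
  have hsu := hmono hu.1
  dsimp only at hsu
  linarith [heq i u (hs.trans hu.1), heq i s hs, hx i s hs]

theorem modCont_le (h : HomogeneousSystem n a x0 w x ℓ) (hn : 1 ≤ n) (ha : 0 ≤ a) (i : Fin n)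
    (T δ : ℝ) : modCont (ℓ i) T δ ≤ modCont (w i) T δ := by
  have key : ∀ s t, s ∈ Icc 0 T → t ∈ Icc 0 T → |s - t| ≤ δ → s ≤ t →
      |ℓ i s - ℓ i t| ≤ modCont (w i) T δ := by
    intro s t hs ht hδ hst
    have hle : ℓ i s ≤ ℓ i t := (h.2.2.2.2.2.1 i).2.1 hst
    rcases hle.eq_or_lt with heq | hlt
    · rw [heq, sub_self, abs_zero]
      exact modCont_nonneg _ _ _
    · obtain ⟨u, hu, hwu⟩ := h.exists_sub_le_of_lt hn ha i hs.1 hst hlt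
      rw [abs_sub_comm, abs_of_pos (sub_pos.2 hlt)]
      refine (hwu.trans (le_abs_self _)).trans (abs_sub_le_modCont (h.2.1 i) hs
        ⟨hs.1.trans hu.1, hu.2.trans ht.2⟩ ?_)
      rw [abs_sub_comm, abs_of_nonneg (sub_nonneg.2 hu.1)]
      rw [abs_sub_comm, abs_of_nonneg (sub_nonneg.2 hst)] at hδ
      linarith [hu.2]
  refine Real.sSup_le ?_ (modCont_nonneg _ _ _)
  rintro _ ⟨⟨s, t⟩, ⟨hs, ht, hδ⟩, rfl⟩
  rcases le_total s t with hst | hts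
  · exact key s t hs ht hδ hst
  · simpa only [abs_sub_comm] using key t s ht hs (by rwa [abs_sub_comm]) hts

theorem le_sSup_nnegPart (h : HomogeneousSystem n a x0 w x ℓ) (hn : 1 ≤ n) (ha : 0 ≤ a)
    (i : Fin n) {t : ℝ} (ht : 0 ≤ t) :
    ℓ i t ≤ sSup ((fun s => nnegPart (w i s)) '' Icc 0 t) := by
  have hw := h.2.1 i
  have h0 : ℓ i 0 = 0 := (h.2.2.2.2.2.1 i).2.2.1 0 le_rfl
  rcases le_or_gt (ℓ i t) 0 with hle | hlt
  · refine hle.trans (Real.sSup_nonneg ?_)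
    rintro _ ⟨s, -, rfl⟩
    exact le_max_right _ _
  · obtain ⟨u, hu, hwu⟩ := h.exists_sub_le_of_lt hn ha i le_rfl ht (by rwa [h0])
    rw [h0, h.2.2.1 i, sub_zero, zero_sub] at hwu
    have hbdd : BddAbove ((fun s => nnegPart (w i s)) '' Icc 0 t) :=
      isCompact_Icc.bddAbove_image (by unfold nnegPart; fun_prop)
    exact (hwu.trans (le_max_left _ _)).trans (le_csSup hbdd ⟨u, hu, rfl⟩)

end HomogeneousSystem

theorem sSup_nnegPart_le_supNorm {f : ℝ → ℝ} (hf : Continuous f) (t : ℝ) :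
    sSup ((fun s => nnegPart (f s)) '' Icc 0 t) ≤ supNorm f t := by
  have hbdd : BddAbove ((fun s => |f s|) '' Icc 0 t) :=
    isCompact_Icc.bddAbove_image (by fun_prop)
  refine Real.sSup_le ?_ (Real.sSup_nonneg ?_)
  · rintro _ ⟨s, hs, rfl⟩
    exact (max_le (neg_le_abs _) (abs_nonneg _)).trans (le_csSup hbdd ⟨s, hs, rfl⟩)
  · rintro _ ⟨s, -, rfl⟩
    exact abs_nonneg _

theorem stmt5 (n : ℕ) (hn : 2 ≤ n) (a : ℝ) (ha : 0 ≤ a)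
    (x0 : Fin n → ℝ) (w x ℓ : Fin n → ℝ → ℝ)
    (hsys : HomogeneousSystem n a x0 w x ℓ) :
    ∀ i,
      (∀ t, 0 ≤ t →
        ℓ i t ≤ sSup ((fun s => nnegPart (w i s)) '' Set.Icc 0 t) ∧
        sSup ((fun s => nnegPart (w i s)) '' Set.Icc 0 t) ≤ supNorm (w i) t) ∧
      (∀ T δ, 0 ≤ δ → δ ≤ T → modCont (ℓ i) T δ ≤ modCont (w i) T δ) := by
  have hn' : 1 ≤ n := one_le_two.trans hn
  exact fun i => ⟨fun t ht => ⟨hsys.le_sSup_nnegPart hn' ha i ht,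
    sSup_nnegPart_le_supNorm (hsys.2.1 i) t⟩, fun T δ _ _ => hsys.modCont_le hn' ha i T δ⟩
end

section
/- Let −1 < a < 0 and let (x_{0,i}, w_i, x_i, ℓ_i)_{i=1,…,n} be a homogeneous reflected system with parameter a. Then for every t ≥ 0, ⟨ℓ(t)⟩ ≤ (1 − |a|)⁻¹ ⟨‖w‖_t⟩, where ⟨ℓ(t)⟩ = n⁻¹∑_{i=1}^n ℓ_i(t) and ⟨‖w‖_t⟩ = n⁻¹∑_{i=1}^n ‖w_i‖_t. -/
open MeasureTheory Set

theorem IsBoundaryTerm.le_of_pos_on_Ioc {x ℓ : ℝ → ℝ} (hx : Continuous x)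
    (h : IsBoundaryTerm x ℓ) {u s : ℝ} (hu : 0 ≤ u) (hpos : ∀ r ∈ Ioc u s, 0 < x r) :
    ℓ s ≤ ℓ u := by
  obtain ⟨hc, hm, -, hint⟩ := h
  rw [lintegral_eq_zero_iff (by fun_prop), Filter.EventuallyEq,
    ae_restrict_iff' measurableSet_Ici, ae_iff] at hint
  have hnull : lsMeasure ℓ (Ioc u s) = 0 := by
    refine measure_mono_null (fun r hr => ?_) hint
    have hxr := hpos r hr
    simpa using ⟨hu.trans hr.1.le, hxr⟩
  rw [lsMeasure, dif_pos ⟨hm, hc⟩, StieltjesFunction.measure_Ioc] at hnull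
  simpa using hnull

theorem IsBoundaryTerm.exists_zero_eq {x ℓ : ℝ → ℝ} (hx : Continuous x)
    (hx0 : ∀ t, 0 ≤ t → 0 ≤ x t) (h : IsBoundaryTerm x ℓ) {t : ℝ} (ht : 0 ≤ t)
    (hlt : 0 < ℓ t) : ∃ s ∈ Icc 0 t, x s = 0 ∧ ℓ s = ℓ t := by
  obtain ⟨hc, hm, hz, -⟩ := id h
  have hcomp : IsCompact (Icc 0 t ∩ ℓ ⁻¹' {ℓ t}) :=
    isCompact_Icc.inter_right (isClosed_singleton.preimage hc)
  obtain ⟨s, ⟨hs, hst⟩, hmin⟩ := hcomp.exists_isLeast ⟨t, ⟨ht, le_rfl⟩, rfl⟩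
  refine ⟨s, hs, ?_, hst⟩
  by_contra hne
  have hpos : 0 < x s := lt_of_le_of_ne (hx0 s hs.1) (Ne.symm hne)
  have hst' : ℓ s = ℓ t := hst
  have hs0 : 0 < s := by
    by_contra! hle
    linarith [hz s hle]
  obtain ⟨δ, hδ, hball⟩ := Metric.eventually_nhds_iff.1
    (hx.continuousAt.eventually (lt_mem_nhds hpos))
  have hu0 : 0 ≤ max 0 (s - δ / 2) := le_max_left _ _
  have hus : max 0 (s - δ / 2) < s := max_lt hs0 (by linarith)
  have hle : ℓ s ≤ ℓ (max 0 (s - δ / 2)) := by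
    refine h.le_of_pos_on_Ioc hx hu0 fun r hr => hball ?_
    have := (le_max_right 0 (s - δ / 2)).trans_lt hr.1
    rw [Real.dist_eq, abs_lt]
    constructor <;> linarith [hr.2]
  have := hmin ⟨⟨hu0, hus.le.trans hs.2⟩, le_antisymm (hm (hus.le.trans hs.2)) (hst' ▸ hle)⟩
  linarith

theorem abs_le_supNorm {f : ℝ → ℝ} (hf : Continuous f) {s t : ℝ} (hs : s ∈ Icc 0 t) :
    |f s| ≤ supNorm f t :=
  le_csSup (isCompact_Icc.image hf.abs).bddAbove ⟨s, hs, rfl⟩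

theorem HomogeneousSystem.boundaryTerm_le {n : ℕ} (hn : 2 ≤ n) {a : ℝ} (ha : a < 0)
    {x0 : Fin n → ℝ} {w x ℓ : Fin n → ℝ → ℝ} (hsys : HomogeneousSystem n a x0 w x ℓ)
    (i : Fin n) {t : ℝ} (ht : 0 ≤ t) :
    ℓ i t ≤ supNorm (w i) t + -a * (((n : ℝ) - 1)⁻¹ * ∑ j ∈ Finset.univ.erase i, ℓ j t) := by
  obtain ⟨hx0, hw, -, hx, hxn, hl, heq⟩ := hsys
  have hn' : (0 : ℝ) ≤ ((n : ℝ) - 1)⁻¹ := by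
    have : (2 : ℝ) ≤ n := by exact_mod_cast hn
    exact inv_nonneg.2 (by linarith)
  have hnonneg : ∀ j, 0 ≤ ℓ j t := fun j =>
    ((hl j).2.2.1 0 le_rfl).symm.le.trans ((hl j).2.1 ht)
  rcases (hnonneg i).eq_or_lt with hzero | hlt
  · rw [← hzero]
    exact add_nonneg ((abs_nonneg _).trans (abs_le_supNorm (hw i) ⟨le_rfl, ht⟩))
      (mul_nonneg (by linarith) (mul_nonneg hn' (Finset.sum_nonneg fun j _ => hnonneg j)))
  · obtain ⟨s, hs, hxs, hls⟩ := (hl i).exists_zero_eq (hx i) (hxn i) ht hlt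
    have h1 := heq i s hs.1
    have h2 := (neg_le_abs _).trans (abs_le_supNorm (hw i) hs)
    have h3 : -a * (((n : ℝ) - 1)⁻¹ * ∑ j ∈ Finset.univ.erase i, ℓ j s) ≤
        -a * (((n : ℝ) - 1)⁻¹ * ∑ j ∈ Finset.univ.erase i, ℓ j t) :=
      mul_le_mul_of_nonneg_left (mul_le_mul_of_nonneg_left
        (Finset.sum_le_sum fun j _ => (hl j).2.1 hs.2) hn') (by linarith)
    linarith [hx0 i]

theorem stmt6 (n : ℕ) (hn : 2 ≤ n) (a : ℝ) (ha1 : -1 < a) (ha2 : a < 0)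
    (x0 : Fin n → ℝ) (w x ℓ : Fin n → ℝ → ℝ)
    (hsys : HomogeneousSystem n a x0 w x ℓ) :
    ∀ t, 0 ≤ t →
      (n : ℝ)⁻¹ * ∑ i, ℓ i t ≤ (1 - |a|)⁻¹ * ((n : ℝ)⁻¹ * ∑ i, supNorm (w i) t) := by
  intro t ht
  have hn' : (2 : ℝ) ≤ n := by exact_mod_cast hn
  have hsum := Finset.sum_le_sum fun i (_ : i ∈ Finset.univ) => hsys.boundaryTerm_le hn ha2 i ht
  have hmean : ∑ i, ((n : ℝ) - 1)⁻¹ * ∑ j ∈ Finset.univ.erase i, ℓ j t = ∑ i, ℓ i t := by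
    have herase : ∀ i, ∑ j ∈ Finset.univ.erase i, ℓ j t = ∑ j, ℓ j t - ℓ i t := fun i =>
      Finset.sum_erase_eq_sub (Finset.mem_univ i)
    have hne : (n : ℝ) - 1 ≠ 0 := by linarith
    simp only [herase, ← Finset.mul_sum, Finset.sum_sub_distrib, Finset.sum_const,
      Finset.card_univ, Fintype.card_fin, nsmul_eq_mul]
    field_simp
  rw [Finset.sum_add_distrib, ← Finset.mul_sum, hmean] at hsum
  rw [abs_of_neg ha2, mul_left_comm]
  refine mul_le_mul_of_nonneg_left ?_ (by positivity)
  rw [inv_mul_eq_div, le_div_iff₀ (by linarith)]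
  linarith
end

section
/- Let n ≥ 2, ε ∈ (0,1], and let u_1,…,u_n and v_1,…,v_n be nonnegative real numbers such that u_i ≤ (1−ε)⟨u⟩_i + v_i for every i, where ⟨u⟩_i = (n−1)⁻¹∑_{j≠i} u_j. Then ⟨u⟩ ≤ ε⁻¹⟨v⟩, where ⟨u⟩ = n⁻¹∑_{i=1}^n u_i and ⟨v⟩ = n⁻¹∑_{i=1}^n v_i. If moreover (1−ε)n/(n−1) ≤ 1 (equivalently, nε ≥ 1), then u_i ≤ ε⁻¹⟨v⟩ + v_i for every i, and consequently max_i u_i ≤ (1 + ε⁻¹) max_i v_i. -/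
open MeasureTheory Set

theorem stmt9 (n : ℕ) (hn : 2 ≤ n) (ε : ℝ) (hε0 : 0 < ε) (hε1 : ε ≤ 1)
    (u v : Fin n → ℝ) (hu : ∀ i, 0 ≤ u i) (hv : ∀ i, 0 ≤ v i)
    (h : ∀ i, u i ≤ (1 - ε) * (((n : ℝ) - 1)⁻¹ * ∑ j ∈ Finset.univ.erase i, u j) + v i) :
    ((n : ℝ)⁻¹ * ∑ i, u i ≤ ε⁻¹ * ((n : ℝ)⁻¹ * ∑ i, v i)) ∧
    ((1 - ε) * (n : ℝ) / ((n : ℝ) - 1) ≤ 1 →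
      (∀ i, u i ≤ ε⁻¹ * ((n : ℝ)⁻¹ * ∑ j, v j) + v i) ∧
      (∀ i, u i ≤ (1 + ε⁻¹) * ⨆ j, v j)) := by
  have hn2 : (2 : ℝ) ≤ n := by exact_mod_cast hn
  have hn0 : (0 : ℝ) < n := by linarith
  have hn1 : (0 : ℝ) < (n : ℝ) - 1 := by linarith
  have herase (i : Fin n) : ∑ j ∈ Finset.univ.erase i, u j = ∑ j, u j - u i :=
    Finset.sum_erase_eq_sub (Finset.mem_univ i)
  have hsum : ∑ i, u i ≤ (1 - ε) * ∑ i, u i + ∑ i, v i := by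
    calc ∑ i, u i
        ≤ ∑ i, ((1 - ε) * (((n : ℝ) - 1)⁻¹ * ∑ j ∈ Finset.univ.erase i, u j) + v i) :=
          Finset.sum_le_sum fun i _ => h i
      _ = (1 - ε) * ∑ i, u i + ∑ i, v i := by
          simp only [herase, Finset.sum_add_distrib, ← Finset.mul_sum, Finset.sum_sub_distrib,
            Finset.sum_const, Finset.card_univ, Fintype.card_fin, nsmul_eq_mul]
          field_simp
  have hmean : (n : ℝ)⁻¹ * ∑ i, u i ≤ ε⁻¹ * ((n : ℝ)⁻¹ * ∑ i, v i) := by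
    rw [mul_left_comm]
    gcongr
    rw [le_inv_mul_iff₀ hε0]
    linarith
  refine ⟨hmean, fun hle => ?_⟩
  have hbound (i : Fin n) : u i ≤ ε⁻¹ * ((n : ℝ)⁻¹ * ∑ j, v j) + v i := by
    have hS : 0 ≤ (n : ℝ)⁻¹ * ∑ j, u j :=
      mul_nonneg (inv_nonneg.2 hn0.le) (Finset.sum_nonneg fun j _ => hu j)
    calc u i
        ≤ (1 - ε) * (((n : ℝ) - 1)⁻¹ * ∑ j ∈ Finset.univ.erase i, u j) + v i := h i
      _ ≤ (1 - ε) * (((n : ℝ) - 1)⁻¹ * ∑ j, u j) + v i := by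
          have h1 : 0 ≤ 1 - ε := sub_nonneg.2 hε1
          rw [herase]
          gcongr
          exact sub_le_self _ (hu i)
      _ = (1 - ε) * n / ((n : ℝ) - 1) * ((n : ℝ)⁻¹ * ∑ j, u j) + v i := by
          field_simp
      _ ≤ (n : ℝ)⁻¹ * ∑ j, u j + v i := by
          linarith [mul_le_of_le_one_left hS hle]
      _ ≤ ε⁻¹ * ((n : ℝ)⁻¹ * ∑ j, v j) + v i := by gcongr
  refine ⟨hbound, fun i => (hbound i).trans ?_⟩
  have hsup (j : Fin n) : v j ≤ ⨆ k, v k := le_ciSup (Finite.bddAbove_range v) j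
  have hmeanv : (n : ℝ)⁻¹ * ∑ j, v j ≤ ⨆ k, v k := by
    rw [inv_mul_le_iff₀ hn0]
    simpa using Finset.sum_le_card_nsmul Finset.univ v _ fun j _ => hsup j
  calc ε⁻¹ * ((n : ℝ)⁻¹ * ∑ j, v j) + v i
      ≤ ε⁻¹ * (⨆ k, v k) + ⨆ k, v k := by gcongr; exact hsup i
    _ = (1 + ε⁻¹) * ⨆ k, v k := by ring
end

section
/- Let a > −1, n ≥ 2, ε > 0, and set α = 1 − a/(n−1) and β = n/(n−1). Suppose (x_{0,i}, w_i, x_i, ℓ_i)_{i=1,…,n} is a homogeneous reflected system with parameter a, and y_i : [0,∞)→ℝ are continuous functions satisfying y_i(t) = x_{0,i} + w_i(t) + λ_i(t) + a⟨λ(t)⟩_i for all t ≥ 0 and all i, where λ_i(t) = ∫₀ᵗ 𝔭_ε(y_i(s)) ds. Then for every t ≥ 0: (1) ⟨x(t) − y(t)⟩ = (1+a)⟨ℓ(t) − λ(t)⟩; and (2) for every i, α|ℓ_i(t) − λ_i(t)| ≤ |x_i(t) − y_i(t)| + |a|β(1+a)⁻¹ ⟨|x(t) − y(t)|⟩, where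 ⟨|x(t)−y(t)|⟩ = n⁻¹∑_{j=1}^n |x_j(t) − y_j(t)|. -/
open MeasureTheory Set

theorem stmt12 (a : ℝ) (ha : -1 < a) (n : ℕ) (hn : 2 ≤ n) (ε : ℝ) (hε : 0 < ε)
    (x0 : Fin n → ℝ) (w x ℓ : Fin n → ℝ → ℝ)
    (hsys : HomogeneousSystem n a x0 w x ℓ)
    (y lam : Fin n → ℝ → ℝ)
    (hy : ∀ i, Continuous (y i))
    (hlam : ∀ i t, lam i t = ∫ s in (0:ℝ)..t, penalty ε (y i s))
    (heq : ∀ i t, 0 ≤ t → y i t = x0 i + w i t + lam i t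
        + a * (((n : ℝ) - 1)⁻¹ * ∑ j ∈ Finset.univ.erase i, lam j t)) :
    ∀ t, 0 ≤ t →
      ((n : ℝ)⁻¹ * ∑ i, (x i t - y i t)
          = (1 + a) * ((n : ℝ)⁻¹ * ∑ i, (ℓ i t - lam i t))) ∧
      (∀ i, (1 - a / ((n : ℝ) - 1)) * |ℓ i t - lam i t|
          ≤ |x i t - y i t|
            + |a| * ((n : ℝ) / ((n : ℝ) - 1)) * (1 + a)⁻¹
              * ((n : ℝ)⁻¹ * ∑ j, |x j t - y j t|)) := by
  obtain ⟨-, -, -, -, -, -, hx⟩ := hsys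
  intro t ht
  have hn2 : (2 : ℝ) ≤ n := by exact_mod_cast hn
  have hn1 : (0 : ℝ) < (n : ℝ) - 1 := by linarith
  have hn0 : (0 : ℝ) < n := by linarith
  have ha1 : 0 < 1 + a := by linarith
  have hdiff : ∀ i, x i t - y i t = (1 - a / ((n : ℝ) - 1)) * (ℓ i t - lam i t)
      + a / ((n : ℝ) - 1) * ∑ j, (ℓ j t - lam j t) := by
    intro i
    rw [hx i t ht, heq i t ht, Finset.sum_erase_eq_sub (Finset.mem_univ i),
      Finset.sum_erase_eq_sub (Finset.mem_univ i), Finset.sum_sub_distrib]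
    ring
  have hsum : ∑ i, (x i t - y i t) = (1 + a) * ∑ i, (ℓ i t - lam i t) := by
    rw [Finset.sum_congr rfl fun i _ => hdiff i, Finset.sum_add_distrib, ← Finset.mul_sum,
      Finset.sum_const, Finset.card_univ, Fintype.card_fin, nsmul_eq_mul]
    field_simp
    ring
  refine ⟨by rw [hsum]; ring, fun i => ?_⟩
  have hS : |∑ j, (ℓ j t - lam j t)| ≤ (1 + a)⁻¹ * ∑ j, |x j t - y j t| := by
    rw [← div_eq_inv_mul, le_div_iff₀ ha1]
    calc |∑ j, (ℓ j t - lam j t)| * (1 + a) = |∑ j, (x j t - y j t)| := by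
          rw [hsum, abs_mul, abs_of_pos ha1, mul_comm]
      _ ≤ ∑ j, |x j t - y j t| := Finset.abs_sum_le_sum_abs _ _
  calc (1 - a / ((n : ℝ) - 1)) * |ℓ i t - lam i t|
      ≤ |(1 - a / ((n : ℝ) - 1)) * (ℓ i t - lam i t)| := by
        rw [abs_mul]
        exact mul_le_mul_of_nonneg_right (le_abs_self _) (abs_nonneg _)
    _ = |(x i t - y i t) - a / ((n : ℝ) - 1) * ∑ j, (ℓ j t - lam j t)| := by
        rw [hdiff i, add_sub_cancel_right]
    _ ≤ |x i t - y i t| + |a / ((n : ℝ) - 1) * ∑ j, (ℓ j t - lam j t)| := abs_sub _ _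
    _ = |x i t - y i t| + |a| / ((n : ℝ) - 1) * |∑ j, (ℓ j t - lam j t)| := by
        rw [abs_mul, abs_div, abs_of_pos hn1]
    _ ≤ |x i t - y i t| + |a| / ((n : ℝ) - 1) * ((1 + a)⁻¹ * ∑ j, |x j t - y j t|) := by
        gcongr
    _ = _ := by
        field_simp
end

section
/- Let t > 0, ε > 0, C > 0, η > 2ε, and κ > 0. Let y, u : [0,t] → ℝ be continuous with u(0) = 0 and y(0) ≥ 0, and let h : [0,t] → ℝ be integrable, such that y(s) = y(0) + u(s) + ∫₀ˢ h(r) dr for all s ∈ [0,t], and h(s) ≥ C/ε for every s with y(s) ≤ −ε. If min_{s∈[0,t]} y(s) ≤ −η, then at least one of the following holds: (i) 2 sup_{s∈[0,t]} |u(s)| ≥ Cε⁻¹κ + η/2; or (ii) there exist s, r ∈ [0,t] with |s − r| ≤ κ and |u(s) − u(r)| ≥ η/2. -/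
open MeasureTheory Set

theorem stmt13 (t ε C η κ : ℝ) (ht : 0 < t) (hε : 0 < ε) (hC : 0 < C)
    (hη : 2 * ε < η) (hκ : 0 < κ)
    (y u : ℝ → ℝ) (h : ℝ → ℝ)
    (hy : ContinuousOn y (Set.Icc 0 t)) (hu : ContinuousOn u (Set.Icc 0 t))
    (hu0 : u 0 = 0) (hy0 : 0 ≤ y 0)
    (hint : MeasureTheory.IntegrableOn h (Set.Icc 0 t))
    (heq : ∀ s ∈ Set.Icc (0:ℝ) t, y s = y 0 + u s + ∫ r in (0:ℝ)..s, h r)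
    (hlow : ∀ s ∈ Set.Icc (0:ℝ) t, y s ≤ -ε → C / ε ≤ h s)
    (hmin : sInf (y '' Set.Icc 0 t) ≤ -η) :
    (C * ε⁻¹ * κ + η / 2 ≤ 2 * sSup ((fun s => |u s|) '' Set.Icc 0 t)) ∨
    (∃ s ∈ Set.Icc (0:ℝ) t, ∃ r ∈ Set.Icc (0:ℝ) t,
      |s - r| ≤ κ ∧ η / 2 ≤ |u s - u r|) := by
  obtain ⟨m, hm, hym⟩ : ∃ m ∈ Icc (0:ℝ) t, y m ≤ -η := by
    obtain ⟨m, hm, hm'⟩ := isCompact_Icc.exists_sInf_image_eq (nonempty_Icc.2 ht.le) hy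
    exact ⟨m, hm, hm' ▸ hmin⟩
  have hsub : Icc 0 m ⊆ Icc 0 t := Icc_subset_Icc le_rfl hm.2
  have hcomp : IsCompact (Icc 0 m ∩ y ⁻¹' Ici (-ε)) :=
    isCompact_Icc.of_isClosed_subset
      ((hy.mono hsub).preimage_isClosed_of_isClosed isClosed_Icc isClosed_Ici) inter_subset_left
  obtain ⟨a, ⟨⟨ha0, ham⟩, hya⟩, hmax⟩ := hcomp.exists_isGreatest
    ⟨0, left_mem_Icc.2 hm.1, show -ε ≤ y 0 by linarith⟩
  have hya : -ε ≤ y a := hya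
  have ha : a ∈ Icc (0:ℝ) t := ⟨ha0, ham.trans hm.2⟩
  have hbelow : ∀ s ∈ Ioo a m, C / ε ≤ h s := by
    intro s hs
    have hs0 : s ∈ Icc 0 m := ⟨ha0.trans hs.1.le, hs.2.le⟩
    refine hlow s (hsub hs0) ?_
    by_contra! hlt
    exact (hmax ⟨hs0, hlt.le⟩).not_gt hs.1
  have hii : ∀ p ∈ Icc (0:ℝ) t, ∀ q ∈ Icc (0:ℝ) t, IntervalIntegrable h volume p q :=
    fun p hp q hq => (hint.mono_set (uIcc_subset_Icc hp hq)).intervalIntegrable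
  have h0 : (0:ℝ) ∈ Icc (0:ℝ) t := left_mem_Icc.2 ht.le
  have hadd := intervalIntegral.integral_add_adjacent_intervals (hii 0 h0 a ha) (hii a ha m hm)
  have hlb : (m - a) * (C / ε) ≤ ∫ r in a..m, h r := by
    have := intervalIntegral.integral_mono_on_of_le_Ioo ham
      (intervalIntegrable_const (c := C / ε)) (hii a ha m hm) hbelow
    rwa [intervalIntegral.integral_const, smul_eq_mul] at this
  have hdrop : η / 2 + (m - a) * (C / ε) ≤ u a - u m := by
    linarith [heq a ha, heq m hm]
  have hrate : 0 < C / ε := div_pos hC hε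
  rcases le_or_gt (m - a) κ with hle | hgt
  · refine Or.inr ⟨a, ha, m, hm, ?_, ?_⟩
    · rwa [abs_sub_comm, abs_of_nonneg (sub_nonneg.2 ham)]
    · have := mul_nonneg (sub_nonneg.2 ham) hrate.le
      exact le_trans (by linarith) (le_abs_self _)
  · left
    have hbdd : BddAbove ((fun s => |u s|) '' Icc 0 t) := isCompact_Icc.bddAbove_image hu.abs
    have h1 := le_csSup hbdd (mem_image_of_mem _ ha)
    have h2 := le_csSup hbdd (mem_image_of_mem _ hm)
    have h3 : κ * (C / ε) ≤ (m - a) * (C / ε) := mul_le_mul_of_nonneg_right hgt.le hrate.le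
    have h4 : C * ε⁻¹ * κ = κ * (C / ε) := by ring
    linarith [le_abs_self (u a), neg_abs_le (u m)]
end
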